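/- There is an absolute constant C > 0 such that for all real x > 1 and all t > 0, |F_t(x) − x/ζ(1+t)| ≤ C ( x^{1−t} + Σ_{d≤x} d^{−t} ). -/

import Mathlib

open Filter Finset

/-- `f_t(m) = Σ_{d∣m} μ(d)/d^t`. -/
noncomputable def ft (t : ℝ) (m : ℕ) : ℝ :=
  ∑ d ∈ m.divisors, (ArithmeticFunction.moebius d : ℝ) / (d : ℝ) ^ t

/-- `F_t(x) = Σ_{1≤m≤x} f_t(m)`. -/
noncomputable def Ft (t : ℝ) (x : ℝ) : ℝ := ∑ m ∈ Finset.Icc 1 ⌊x⌋₊, ft t m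

open ArithmeticFunction in
/-- Summing over divisors first: `Σ_{m ≤ N} f_t(m) = Σ_{d ≤ N} μ(d) d^{-t} ⌊N / d⌋`. -/
lemma sum_ft_eq (t : ℝ) (N : ℕ) :
    ∑ m ∈ Ioc 0 N, ft t m =
      ∑ d ∈ Ioc 0 N, (moebius d : ℝ) / (d : ℝ) ^ t * ((N / d : ℕ) : ℝ) := by
  let f : ArithmeticFunction ℝ := ⟨fun d ↦ (moebius d : ℝ) / (d : ℝ) ^ t, by simp⟩
  have h := sum_Ioc_mul_zeta_eq_sum f N
  simp only [coe_mul_zeta_apply] at h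
  exact h

open ArithmeticFunction in
lemma sum_moebius_mul_div_eq_one {N : ℕ} (hN : 1 ≤ N) :
    ∑ d ∈ Ioc 0 N, (moebius d : ℝ) * ((N / d : ℕ) : ℝ) = 1 := by
  have h := sum_Ioc_mul_zeta_eq_sum (moebius : ArithmeticFunction ℝ) N
  rw [coe_moebius_mul_coe_zeta] at h
  simp only [intCoe_apply] at h
  rw [← h, Finset.sum_eq_single 1]
  · simp
  · intro b _ hb
    exact one_apply_ne hb
  · intro h1
    simp at h1
    omega

lemma abs_moebius_real_le_one (d : ℕ) : |(ArithmeticFunction.moebius d : ℝ)| ≤ 1 := by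
  exact_mod_cast ArithmeticFunction.abs_moebius_le_one (n := d)

/-- The distance between `y / d` and `⌊⌊y⌋ / d⌋` is at most `1`. -/
lemma abs_natFloor_div_sub_le_one {y : ℝ} (hy : 0 ≤ y) {d : ℕ} (hd : 0 < d) :
    |((⌊y⌋₊ / d : ℕ) : ℝ) - y / d| ≤ 1 := by
  rw [← Nat.floor_div_natCast]
  have hyd : 0 ≤ y / d := by positivity
  have h1 := Nat.floor_le hyd
  have h2 := Nat.lt_floor_add_one (y / d)
  rw [abs_le]
  constructor <;> linarith

/-- The partial sums of `Σ μ(d) / d` are bounded. -/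
lemma abs_sum_moebius_div_le_two (N : ℕ) :
    |∑ d ∈ Ioc 0 N, (ArithmeticFunction.moebius d : ℝ) / d| ≤ 2 := by
  rcases Nat.eq_zero_or_pos N with rfl | hN
  · simp
  have hN' : (0 : ℝ) < N := by exact_mod_cast hN
  have key : |∑ d ∈ Ioc 0 N, (ArithmeticFunction.moebius d : ℝ) *
      (((N / d : ℕ) : ℝ) - (N : ℝ) / d)| ≤ N := by
    calc _ ≤ ∑ d ∈ Ioc 0 N, |(ArithmeticFunction.moebius d : ℝ) *
          (((N / d : ℕ) : ℝ) - (N : ℝ) / d)| := abs_sum_le_sum_abs _ _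
      _ ≤ ∑ d ∈ Ioc 0 N, (1 : ℝ) := by
          refine sum_le_sum fun d hd ↦ ?_
          rw [abs_mul]
          have h := abs_natFloor_div_sub_le_one hN'.le (mem_Ioc.1 hd).1
          rw [Nat.floor_natCast] at h
          exact mul_le_one₀ (abs_moebius_real_le_one d) (abs_nonneg _) h
      _ = N := by simp
  have heq : ∑ d ∈ Ioc 0 N, (ArithmeticFunction.moebius d : ℝ) *
      (((N / d : ℕ) : ℝ) - (N : ℝ) / d) =
      1 - N * ∑ d ∈ Ioc 0 N, (ArithmeticFunction.moebius d : ℝ) / d := by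
    rw [← sum_moebius_mul_div_eq_one hN, mul_sum, ← sum_sub_distrib]
    exact sum_congr rfl fun d _ ↦ by ring
  rw [heq, abs_le] at key
  have h1 : (1 : ℝ) ≤ N := by exact_mod_cast hN
  rw [abs_le]
  constructor <;> nlinarith [key.1, key.2]

/-- Abel's inequality: a sum of increments of a bounded sequence with antitone nonnegative
weights. -/
lemma abs_sum_increments_mul_le {A w : ℕ → ℝ} {B : ℝ} (hA : ∀ n, |A n| ≤ B)
    (hw : Antitone w) (hw0 : ∀ n, 0 ≤ w n) (n : ℕ) :
    |∑ k ∈ range n, (A (k + 1) - A k) * w k| ≤ 2 * B * w 0 := by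
  have key : |∑ k ∈ range n, (A (k + 1) - A k) * w k - A n * w n| ≤ B * (2 * w 0 - w n) := by
    induction n with
    | zero =>
      simp only [range_zero, sum_empty, zero_sub, abs_neg, abs_mul, abs_of_nonneg (hw0 0)]
      nlinarith [mul_le_mul_of_nonneg_right (hA 0) (hw0 0)]
    | succ n ih =>
      have hd : 0 ≤ w n - w (n + 1) := sub_nonneg.2 (hw n.le_succ)
      calc _ = |(∑ k ∈ range n, (A (k + 1) - A k) * w k - A n * w n) +
            A (n + 1) * (w n - w (n + 1))| := by rw [sum_range_succ]; congr 1; ring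
        _ ≤ B * (2 * w 0 - w n) + B * (w n - w (n + 1)) := by
            refine (abs_add_le _ _).trans (add_le_add ih ?_)
            rw [abs_mul, abs_of_nonneg hd]
            exact mul_le_mul_of_nonneg_right (hA _) hd
        _ = _ := by ring
  have h2 : |A n * w n| ≤ B * w n := by
    rw [abs_mul, abs_of_nonneg (hw0 n)]
    exact mul_le_mul_of_nonneg_right (hA n) (hw0 n)
  rw [abs_le] at *
  constructor <;> linarith [key.1, key.2, h2.1, h2.2]

/-- Tails of `Σ μ(d) / d^{1+t}` beyond `x` are `O(x^{-t})`, uniformly in `t > 0`. -/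
lemma abs_sum_moebius_tail_le {x t : ℝ} (hx : 0 < x) (ht : 0 < t) (n : ℕ) :
    |∑ d ∈ Ioc ⌊x⌋₊ (⌊x⌋₊ + n), (ArithmeticFunction.moebius d : ℝ) / (d : ℝ) ^ (1 + t)| ≤
      4 * x ^ (-t) := by
  set N := ⌊x⌋₊
  let A : ℕ → ℝ := fun k ↦ ∑ d ∈ Ioc 0 (N + k), (ArithmeticFunction.moebius d : ℝ) / d
  let w : ℕ → ℝ := fun k ↦ ((N + k + 1 : ℕ) : ℝ) ^ (-t)
  have hw : Antitone w := fun a b hab ↦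
    Real.rpow_le_rpow_of_nonpos (by positivity) (by exact_mod_cast (by omega)) (by linarith)
  have h := abs_sum_increments_mul_le (A := A) (fun n ↦ abs_sum_moebius_div_le_two (N + n)) hw
    (fun n ↦ by positivity) n
  have hsum : ∑ d ∈ Ioc N (N + n), (ArithmeticFunction.moebius d : ℝ) / (d : ℝ) ^ (1 + t) =
      ∑ k ∈ range n, (A (k + 1) - A k) * w k := by
    induction n with
    | zero => simp
    | succ n ih =>
      rw [← add_assoc, sum_Ioc_succ_top (by omega), sum_range_succ, ih
        (abs_sum_increments_mul_le (A := A) (fun n ↦ abs_sum_moebius_div_le_two (N + n)) hw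
          (fun n ↦ by positivity) n)]
      congr 1
      have hA : A (n + 1) - A n =
          (ArithmeticFunction.moebius (N + n + 1) : ℝ) / ((N + n + 1 : ℕ) : ℝ) := by
        simp only [A]
        rw [← add_assoc, sum_Ioc_succ_top (by omega)]
        ring
      have hpos : (0 : ℝ) < ((N + n + 1 : ℕ) : ℝ) := by positivity
      rw [hA, Real.rpow_add hpos, Real.rpow_one]
      simp only [w]
      rw [Real.rpow_neg hpos.le]
      field_simp
  rw [hsum]
  have hw0 : w 0 ≤ x ^ (-t) :=
    Real.rpow_le_rpow_of_nonpos hx (by simpa using (Nat.lt_floor_add_one x).le) (by linarith)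
  linarith

/-- The truncated main term approximates `F_t(x)` up to `Σ_{d ≤ x} d^{-t}`. -/
lemma abs_Ft_sub_le {x t : ℝ} (hx : 0 < x) :
    |Ft t x - x * ∑ d ∈ Ioc 0 ⌊x⌋₊, (ArithmeticFunction.moebius d : ℝ) / (d : ℝ) ^ (1 + t)| ≤
      ∑ d ∈ Ioc 0 ⌊x⌋₊, (d : ℝ) ^ (-t) := by
  have hF : Ft t x = ∑ m ∈ Ioc 0 ⌊x⌋₊, ft t m := rfl
  rw [hF, sum_ft_eq, mul_sum, ← sum_sub_distrib]
  refine (abs_sum_le_sum_abs _ _).trans (sum_le_sum fun d hd ↦ ?_)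
  have hd0 := (mem_Ioc.1 hd).1
  have hpos : (0 : ℝ) < d := by exact_mod_cast hd0
  have heq : (ArithmeticFunction.moebius d : ℝ) / (d : ℝ) ^ t * ((⌊x⌋₊ / d : ℕ) : ℝ) -
      x * ((ArithmeticFunction.moebius d : ℝ) / (d : ℝ) ^ (1 + t)) =
      (ArithmeticFunction.moebius d : ℝ) * (((⌊x⌋₊ / d : ℕ) : ℝ) - x / d) * (d : ℝ) ^ (-t) := by
    rw [Real.rpow_add hpos, Real.rpow_one, Real.rpow_neg hpos.le]
    field_simp
  rw [heq, abs_mul, abs_mul, abs_of_nonneg (Real.rpow_nonneg hpos.le (-t))]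
  exact mul_le_of_le_one_left (Real.rpow_nonneg hpos.le _) (mul_le_one₀
    (abs_moebius_real_le_one d) (abs_nonneg _) (abs_natFloor_div_sub_le_one hx.le hd0))

open ArithmeticFunction in
lemma tendsto_sum_moebius_div_rpow {t : ℝ} (ht : 0 < t) :
    Tendsto (fun n : ℕ ↦ ((∑ d ∈ Ioc 0 n, (moebius d : ℝ) / (d : ℝ) ^ (1 + t) : ℝ) : ℂ)) atTop
      (nhds (riemannZeta ((1 + t : ℝ) : ℂ))⁻¹) := by
  have hs : 1 < ((1 + t : ℝ) : ℂ).re := by simpa using ht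
  have hval : LSeries (fun n ↦ (moebius n : ℂ)) ((1 + t : ℝ) : ℂ) =
      (riemannZeta ((1 + t : ℝ) : ℂ))⁻¹ := by
    have h := LSeries_zeta_mul_Lseries_moebius hs
    rw [LSeries_zeta_eq_riemannZeta hs] at h
    exact eq_inv_of_mul_eq_one_right h
  have hsum := (LSeriesSummable_moebius_iff.2 hs).LSeriesHasSum
  rw [hval] at hsum
  refine ((HasSum.tendsto_sum_nat hsum).comp (tendsto_add_atTop_nat 1)).congr fun n ↦ ?_
  simp only [Function.comp_apply]
  rw [sum_range_succ', LSeries.term_zero, add_zero, Complex.ofReal_sum]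
  induction n with
  | zero => simp
  | succ n ih =>
    rw [sum_range_succ, ih, sum_Ioc_succ_top (by omega), LSeries.term_of_ne_zero (by omega)]
    congr 1
    rw [Complex.ofReal_div, Complex.ofReal_cpow (by positivity)]
    simp

/-- There is an absolute `C > 0` such that for all `x > 1` and `t > 0`,
`|F_t(x) − x/ζ(1+t)| ≤ C (x^{1−t} + Σ_{d≤x} d^{−t})`. -/
theorem stmt_7 :
    ∃ C : ℝ, 0 < C ∧ ∀ x : ℝ, 1 < x → ∀ t : ℝ, 0 < t →
      ‖(Ft t x : ℂ) - (x : ℂ) / riemannZeta ((1 + t : ℝ) : ℂ)‖ ≤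
        C * (x ^ (1 - t) + ∑ d ∈ Finset.Icc 1 ⌊x⌋₊, (d : ℝ) ^ (-t)) := by
  refine ⟨4, by norm_num, fun x hx t ht ↦ ?_⟩
  have hx0 : 0 < x := by linarith
  have hlim := ((tendsto_sum_moebius_div_rpow ht).const_mul (x : ℂ)).const_sub (Ft t x : ℂ)
  rw [div_eq_mul_inv]
  refine le_of_tendsto hlim.norm ?_
  filter_upwards [eventually_ge_atTop ⌊x⌋₊] with M hM
  obtain ⟨n, rfl⟩ := Nat.exists_eq_add_of_le hM
  rw [← Complex.ofReal_mul, ← Complex.ofReal_sub, Complex.norm_real, Real.norm_eq_abs,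
    ← sum_Ioc_consecutive _ (Nat.zero_le _) hM]
  have h1 := abs_Ft_sub_le (t := t) hx0
  have h2 := mul_le_mul_of_nonneg_left (abs_sum_moebius_tail_le hx0 ht n) hx0.le
  have hxt : x ^ (1 - t) = x * x ^ (-t) := by
    rw [sub_eq_add_neg, Real.rpow_add hx0, Real.rpow_one]
  rw [← abs_of_pos hx0, ← abs_mul, abs_of_pos hx0] at h2
  have hD : (0 : ℝ) ≤ ∑ d ∈ Ioc 0 ⌊x⌋₊, (d : ℝ) ^ (-t) :=
    sum_nonneg fun d _ ↦ by positivity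
  have hI : Finset.Icc 1 ⌊x⌋₊ = Ioc 0 ⌊x⌋₊ := rfl
  rw [hI, hxt, mul_add, ← sub_sub]
  refine (abs_sub _ _).trans ?_
  linarith
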